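/- arXiv:2410.04275 — 3 statements merged into one kernel-verified Lean document; each statement's English description precedes it below -/
import Mathlib

section
/- Suppose the pool U is a finite set, S ⊆ U, and x_i ∈ S. Suppose perplexity scores evolve over iterations t = 0, 1, 2, … by the reweighting rule P_{t+1}(x) = P_t(x) − β·A_t(x), where A_t(x) = (1/|L_t|)·Σ_{l∈L_t} |P_t(x) − P_t(l)| and L_t is a nonempty finite set of labeled instances with perplexity scores P_t(l). Assume β > 0, δ > ε ≥ 0, and that at every iteration t: |P_t(x_i) − P_t(l)| ≥ δ for all l ∈ L_t, and |P_t(x_j) − P_t(l)| ≤ ε for all l ∈ L_t and every x_j ∈ U \ S. Then there exists a finite iteration T such that P_T(x_i) ≤ P_T(x_j) for every x_j ∈ U \ S; consequently at iteration T the number of x ∈ U with P_T(x) < P_T(x_i) is at most |S| − 1, so x_i is among the |S| instances of lowest perplexity. -/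
/-- A per-step gap of `c` between the decrements of two sequences accumulates linearly. -/
theorem sub_le_sub_nat_mul_of_step {u v : ℕ → ℝ} {c : ℝ}
    (h : ∀ t, u (t + 1) - v (t + 1) ≤ u t - v t - c) (t : ℕ) :
    u t - v t ≤ u 0 - v 0 - t * c := by
  induction t with
  | zero => simp
  | succ t ih =>
    push_cast
    linarith [h t]

/-- If the decrements of `u` exceed those of `v` by a fixed positive amount, then `u` is
eventually below `v`. -/
theorem eventually_le_of_step {u v : ℕ → ℝ} {c : ℝ} (hc : 0 < c)
    (h : ∀ t, u (t + 1) - v (t + 1) ≤ u t - v t - c) :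
    ∀ᶠ t in Filter.atTop, u t ≤ v t := by
  have hlim : Filter.Tendsto (fun t : ℕ => (t : ℝ) * c) Filter.atTop Filter.atTop :=
    tendsto_natCast_atTop_atTop.atTop_mul_const hc
  filter_upwards [hlim.eventually_ge_atTop (u 0 - v 0)] with t ht
  linarith [sub_le_sub_nat_mul_of_step h t]

theorem le_sum_div_card {α : Type*} {s : Finset α} (hs : s.Nonempty) {f : α → ℝ} {a : ℝ}
    (h : ∀ x ∈ s, a ≤ f x) : a ≤ (∑ x ∈ s, f x) / s.card := by
  rw [le_div_iff₀ (by exact_mod_cast hs.card_pos), mul_comm]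
  simpa using s.card_nsmul_le_sum f a h

theorem sum_div_card_le {α : Type*} {s : Finset α} (hs : s.Nonempty) {f : α → ℝ} {a : ℝ}
    (h : ∀ x ∈ s, f x ≤ a) : (∑ x ∈ s, f x) / s.card ≤ a := by
  rw [div_le_iff₀ (by exact_mod_cast hs.card_pos), mul_comm]
  simpa using s.sum_le_card_nsmul f a h

/-- If `f a ≤ f x` for every `x ∈ U \ S`, where `a ∈ S`, then at most `|S| - 1` elements of `U`
have a value below `f a`. -/
theorem card_filter_lt_le_card_sub_one {α : Type*} [DecidableEq α] {U S : Finset α} {a : α}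
    (ha : a ∈ S) {f : α → ℝ} (h : ∀ x ∈ U \ S, f a ≤ f x) :
    (U.filter (fun x => f x < f a)).card ≤ S.card - 1 := by
  rw [← Finset.card_erase_of_mem ha]
  refine Finset.card_le_card fun x hx => ?_
  obtain ⟨hxU, hlt⟩ := Finset.mem_filter.1 hx
  refine Finset.mem_erase.2 ⟨fun hxa => (hxa ▸ hlt).false, ?_⟩
  by_contra hxS
  exact (h x (Finset.mem_sdiff.2 ⟨hxU, hxS⟩)).not_gt hlt

/-- Proposition 1 (ActivePrune): under perplexity reweighting, an underrepresented
instance `xi ∈ S` eventually has perplexity no greater than every `xj ∈ U \ S`,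
hence ranks among the `|S|` lowest-perplexity instances of the pool `U`. -/
theorem activeprune_prop1 {α : Type*} [DecidableEq α]
    (U S : Finset α) (hSU : S ⊆ U) (xi : α) (hxi : xi ∈ S)
    (P : ℕ → α → ℝ) (L : ℕ → Finset α) (hL : ∀ t, (L t).Nonempty)
    (β δ ε : ℝ) (hβ : 0 < β) (hδε : ε < δ) (hε : 0 ≤ ε)
    (hupd : ∀ t x, P (t + 1) x =
      P t x - β * ((∑ l ∈ L t, |P t x - P t l|) / (L t).card))
    (hi : ∀ t, ∀ l ∈ L t, δ ≤ |P t xi - P t l|)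
    (hj : ∀ t, ∀ xj ∈ U \ S, ∀ l ∈ L t, |P t xj - P t l| ≤ ε) :
    ∃ T : ℕ, (∀ xj ∈ U \ S, P T xi ≤ P T xj) ∧
      (U.filter (fun x => P T x < P T xi)).card ≤ S.card - 1 := by
  have hev : ∀ᶠ t in Filter.atTop, ∀ xj ∈ U \ S, P t xi ≤ P t xj := by
    refine (Filter.eventually_all_finset _).2 fun xj hxj => ?_
    refine eventually_le_of_step (mul_pos hβ (sub_pos.2 hδε)) fun t => ?_
    have h₁ := mul_le_mul_of_nonneg_left (le_sum_div_card (hL t) (hi t)) hβ.le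
    have h₂ := mul_le_mul_of_nonneg_left (sum_div_card_le (hL t) (hj t xj hxj)) hβ.le
    rw [hupd t xi, hupd t xj]
    linarith
  obtain ⟨T, hT⟩ := hev.exists
  exact ⟨T, hT, card_filter_lt_le_card_sub_one hxi hT⟩
end

section
/- Suppose perplexity scores evolve over iterations t = 0, 1, 2, … by P_{t+1}(x) = P_t(x) − β·A_t(x), where A_t(x) = (1/|L_t|)·Σ_{l∈L_t} |P_t(x) − P_t(l)| and L_t is a nonempty finite set of labeled instances with perplexities P_t(l). Let β > 0 and δ > ε ≥ 0, set Δ = β·(δ − ε) > 0 and D_0 = P_0(x_i) − P_0(x_j), and suppose that at every iteration t: |P_t(x_i) − P_t(l)| ≥ δ for all l ∈ L_t and |P_t(x_j) − P_t(l)| ≤ ε for all l ∈ L_t. Then for every natural number T with T ≥ D_0/Δ (in particular for T = ⌈D_0/Δ⌉ when D_0 > 0), one has P_T(x_i) ≤ P_T(x_j); moreover P_t(x_i) ≤ P_t(x_j) for all t ≥ T. -/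
/-- A sequence that drops by at least `Δ` at each step lies below the line of slope `-Δ`. -/
theorem le_sub_mul_of_succ_le_sub {D : ℕ → ℝ} {Δ : ℝ} (h : ∀ t, D (t + 1) ≤ D t - Δ) (t : ℕ) :
    D t ≤ D 0 - t * Δ := by
  induction t with
  | zero => simp
  | succ t ih =>
    push_cast
    linarith [h t]

/-- Crossing time: with `Δ = β·(δ − ε) > 0` and `D₀ = P₀(xi) − P₀(xj)`, for every
natural number `T ≥ D₀ / Δ` one has `P_T(xi) ≤ P_T(xj)`, and moreover
`P_t(xi) ≤ P_t(xj)` for all `t ≥ T`. -/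
theorem perplexity_crossing_time {α : Type*}
    (P : ℕ → α → ℝ) (L : ℕ → Finset α) (hL : ∀ t, (L t).Nonempty)
    (β δ ε : ℝ) (hβ : 0 < β) (hδε : ε < δ) (hε : 0 ≤ ε)
    (xi xj : α)
    (hupd : ∀ t x, P (t + 1) x =
      P t x - β * ((∑ l ∈ L t, |P t x - P t l|) / (L t).card))
    (hi : ∀ t, ∀ l ∈ L t, δ ≤ |P t xi - P t l|)
    (hj : ∀ t, ∀ l ∈ L t, |P t xj - P t l| ≤ ε) :
    ∀ T : ℕ, (P 0 xi - P 0 xj) / (β * (δ - ε)) ≤ (T : ℝ) →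
      P T xi ≤ P T xj ∧ ∀ t : ℕ, T ≤ t → P t xi ≤ P t xj := by
  have hgap (t : ℕ) : P t xi - P t xj ≤ (P 0 xi - P 0 xj) - t * (β * (δ - ε)) := by
    refine le_sub_mul_of_succ_le_sub (D := fun t => P t xi - P t xj) (fun t => ?_) t
    have hcard : (0 : ℝ) < (L t).card := by exact_mod_cast (hL t).card_pos
    have hlow : δ ≤ (∑ l ∈ L t, |P t xi - P t l|) / (L t).card := by
      rw [le_div_iff₀ hcard, mul_comm, ← nsmul_eq_mul]
      exact Finset.card_nsmul_le_sum _ _ _ (hi t)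
    have hupp : (∑ l ∈ L t, |P t xj - P t l|) / (L t).card ≤ ε := by
      rw [div_le_iff₀ hcard, mul_comm, ← nsmul_eq_mul]
      exact Finset.sum_le_card_nsmul _ _ _ (hj t)
    simp only [hupd t xi, hupd t xj]
    linarith [mul_le_mul_of_nonneg_left hlow hβ.le, mul_le_mul_of_nonneg_left hupp hβ.le]
  intro T hT
  have hΔ : 0 < β * (δ - ε) := mul_pos hβ (sub_pos.mpr hδε)
  rw [div_le_iff₀ hΔ] at hT
  have hcross (t : ℕ) (ht : T ≤ t) : P t xi ≤ P t xj := by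
    have hmono : (T : ℝ) * (β * (δ - ε)) ≤ t * (β * (δ - ε)) := by gcongr
    linarith [hgap t]
  exact ⟨hcross T le_rfl, hcross⟩
end

section
/- Suppose the pool U is a finite set, S ⊆ U, x_i ∈ S, and perplexity scores evolve over iterations t = 0, 1, 2, … by P_{t+1}(x) = P_t(x) − β·A_t(x), where A_t(x) = (1/|L_t|)·Σ_{l∈L_t} |P_t(x) − P_t(l)| and L_t is a nonempty finite set of labeled instances with perplexities P_t(l). Assume β > 0, δ > ε ≥ 0, and at every iteration t: |P_t(x_i) − P_t(l)| ≥ δ for all l ∈ L_t, and |P_t(x_j) − P_t(l)| ≤ ε for all l ∈ L_t and every x_j ∈ U \ S. Then there exists a natural number T* such that for every t ≥ T* and every x_j ∈ U \ S, P_t(x_i) ≤ P_t(x_j). -/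
/-- Eventual dominance: under perplexity reweighting, there is a finite iteration
`T*` after which the underrepresented instance `xi ∈ S` has perplexity no greater
than that of every `xj ∈ U \ S`. -/
theorem perplexity_eventual_dominance {α : Type*} [DecidableEq α]
    (U S : Finset α) (hSU : S ⊆ U) (xi : α) (hxi : xi ∈ S)
    (P : ℕ → α → ℝ) (L : ℕ → Finset α) (hL : ∀ t, (L t).Nonempty)
    (β δ ε : ℝ) (hβ : 0 < β) (hδε : ε < δ) (hε : 0 ≤ ε)
    (hupd : ∀ t x, P (t + 1) x =
      P t x - β * ((∑ l ∈ L t, |P t x - P t l|) / (L t).card))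
    (hi : ∀ t, ∀ l ∈ L t, δ ≤ |P t xi - P t l|)
    (hj : ∀ t, ∀ xj ∈ U \ S, ∀ l ∈ L t, |P t xj - P t l| ≤ ε) :
    ∃ Tstar : ℕ, ∀ t : ℕ, Tstar ≤ t → ∀ xj ∈ U \ S, P t xi ≤ P t xj := by
  have card_pos : ∀ t, (0 : ℝ) < (L t).card := fun t => by
    exact_mod_cast (hL t).card_pos
  have le_avg : ∀ t, δ ≤ (∑ l ∈ L t, |P t xi - P t l|) / (L t).card := fun t => by
    rw [le_div_iff₀ (card_pos t), mul_comm, ← nsmul_eq_mul]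
    exact Finset.card_nsmul_le_sum _ _ _ (hi t)
  have avg_le : ∀ t, ∀ xj ∈ U \ S,
      (∑ l ∈ L t, |P t xj - P t l|) / (L t).card ≤ ε := fun t xj hxj => by
    rw [div_le_iff₀ (card_pos t), mul_comm, ← nsmul_eq_mul]
    exact Finset.sum_le_card_nsmul _ _ _ (hj t xj hxj)
  have gap : ∀ xj ∈ U \ S, ∀ t : ℕ,
      P t xi - P t xj ≤ P 0 xi - P 0 xj - t * (β * (δ - ε)) := by
    intro xj hxj t
    induction t with
    | zero => simp
    | succ t ih =>
      have h₁ := mul_le_mul_of_nonneg_left (le_avg t) hβ.le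
      have h₂ := mul_le_mul_of_nonneg_left (avg_le t xj hxj) hβ.le
      rw [hupd t xi, hupd t xj]
      push_cast
      linarith
  rw [← Filter.eventually_atTop, Filter.eventually_all_finset]
  intro xj hxj
  have hΔ : 0 < β * (δ - ε) := mul_pos hβ (sub_pos.mpr hδε)
  filter_upwards [Filter.eventually_ge_atTop ⌈(P 0 xi - P 0 xj) / (β * (δ - ε))⌉₊] with t ht
  have h := (div_le_iff₀ hΔ).mp (Nat.ceil_le.mp ht)
  linarith [gap xj hxj t]
end
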